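/- Let Q be a POST channel with |𝒳| = |𝒴| such that every channel transition matrix 𝑄^{(c)}_{y′} is invertible, and let P* be a maximizer of the optimization problem defining C*_f(Q). Let n be a positive integer, and let P_{X^n Y_0} be a joint pmf on 𝒳^n × 𝒴 with Y_0-marginal equal to P*_{Y′} such that, under the induced law P_{X^n Y^n Y_0}(x^n,y^n,y_0) = P_{X^n Y_0}(x^n,y_0) ∏_{t=1}^n Q(y_t|x_t,y_{t−1}), the output law satisfies P_{Y^n Y_0}(y^n,y_0) = P*_{Y′}(y_0) ∏_{t=1}^n P*_{Y|Y′}(y_t|y_{t−1}). Then I(X^n;Y^n|Y_0) = n · C*_f(Q), and consequently C_n(Q) ≥ C*_f(Q). -/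

import Mathlib

open scoped BigOperators

noncomputable section

/-- Conditional mutual information `I(A;B|C)` for a joint pmf `P` on finite types,
with the conventions `0 · log 0 = 0` (and division by zero equal to zero)
and natural logarithm. -/
def condMI {A B C : Type*} [Fintype A] [Fintype B] [Fintype C]
    (P : A → B → C → ℝ) : ℝ :=
  ∑ a : A, ∑ b : B, ∑ c : C,
    P a b c *
      Real.log ((P a b c * ∑ a' : A, ∑ b' : B, P a' b' c) /
        ((∑ b' : B, P a b' c) * (∑ a' : A, P a' b c)))

/-- `Q x y' y` represents the POST-channel transition kernel `Q(y | x, y')`. -/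
def IsPOST {X Y : Type*} [Fintype X] [Fintype Y] (Q : X → Y → Y → ℝ) : Prop :=
  (∀ x y' y, 0 ≤ Q x y' y) ∧ ∀ x y', ∑ y : Y, Q x y' y = 1

/-- A joint pmf `P(x, y')` on `X × Y`. -/
def IsJointPmf {X Y : Type*} [Fintype X] [Fintype Y] (P : X → Y → ℝ) : Prop :=
  (∀ x y, 0 ≤ P x y) ∧ ∑ x : X, ∑ y : Y, P x y = 1

/-- The stationarity constraint `∑_{x,y'} P(x,y') Q(y|x,y') = ∑_x P(x,y)` for all `y`. -/
def StationaryFor {X Y : Type*} [Fintype X] [Fintype Y]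
    (Q : X → Y → Y → ℝ) (P : X → Y → ℝ) : Prop :=
  ∀ y : Y, ∑ x : X, ∑ y' : Y, P x y' * Q x y' y = ∑ x : X, P x y

/-- `I(X;Y|Y')` computed under the joint law `P(x,y') Q(y|x,y')`. -/
def fbMI {X Y : Type*} [Fintype X] [Fintype Y]
    (Q : X → Y → Y → ℝ) (P : X → Y → ℝ) : ℝ :=
  condMI (fun (x : X) (y : Y) (y' : Y) => P x y' * Q x y' y)

/-- `P` is a maximizer of the optimization problem defining `C*_f(Q)`. -/
def IsFbMaximizer {X Y : Type*} [Fintype X] [Fintype Y]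
    (Q : X → Y → Y → ℝ) (P : X → Y → ℝ) : Prop :=
  IsJointPmf P ∧ StationaryFor Q P ∧
    ∀ P' : X → Y → ℝ, IsJointPmf P' → StationaryFor Q P' → fbMI Q P' ≤ fbMI Q P

/-- The feedback capacity functional `C*_f(Q)`. -/
def Cfstar {X Y : Type*} [Fintype X] [Fintype Y] (Q : X → Y → Y → ℝ) : ℝ :=
  sSup {r : ℝ | ∃ P : X → Y → ℝ, IsJointPmf P ∧ StationaryFor Q P ∧ fbMI Q P = r}

/-- The state preceding time `t` in a length-`n` block with initial state `y0`. -/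
def prevState {Y : Type*} (n : ℕ) (y0 : Y) (ys : Fin n → Y) (t : Fin n) : Y :=
  if (t : ℕ) = 0 then y0
  else ys ⟨(t : ℕ) - 1, lt_of_le_of_lt (Nat.sub_le _ _) t.isLt⟩

/-- A joint pmf `P(x^n, y_0)` on `𝒳^n × 𝒴`. -/
def IsJointPmfN {X Y : Type*} [Fintype X] [Fintype Y] (n : ℕ)
    (P : (Fin n → X) → Y → ℝ) : Prop :=
  (∀ xs y0, 0 ≤ P xs y0) ∧ ∑ xs : Fin n → X, ∑ y0 : Y, P xs y0 = 1

/-- The induced joint law `P(x^n,y_0) ∏_{t=1}^n Q(y_t|x_t,y_{t-1})`. -/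
def nLaw {X Y : Type*} [Fintype X] [Fintype Y]
    (Q : X → Y → Y → ℝ) (n : ℕ) (P : (Fin n → X) → Y → ℝ) :
    (Fin n → X) → (Fin n → Y) → Y → ℝ :=
  fun xs ys y0 => P xs y0 * ∏ t : Fin n, Q (xs t) (prevState n y0 ys t) (ys t)

/-- `C_n(Q) = (1/n) max_{P_{X^n Y_0}} I(X^n; Y^n | Y_0)`. -/
def Cn {X Y : Type*} [Fintype X] [Fintype Y] (Q : X → Y → Y → ℝ) (n : ℕ) : ℝ :=
  sSup {r : ℝ | ∃ P : (Fin n → X) → Y → ℝ, IsJointPmfN n P ∧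
    r = (1 / (n : ℝ)) * condMI (nLaw Q n P)}

/-- A pmf on a finite set. -/
def IsPmf {X : Type*} [Fintype X] (p : X → ℝ) : Prop :=
  (∀ x, 0 ≤ p x) ∧ ∑ x : X, p x = 1

/-- The mutual information `I(X;Y)` across the memoryless channel `W` with input pmf `p`. -/
def mlMI {X Y : Type*} [Fintype X] [Fintype Y] (W : X → Y → ℝ) (p : X → ℝ) : ℝ :=
  ∑ x : X, ∑ y : Y, p x * W x y * Real.log (W x y / ∑ x' : X, p x' * W x' y)

/-- The conditional output kernel `P_{Y|Y'}(y|y') = ∑_x P_{X|Y'}(x|y') Q(y|x,y')`. -/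
def condOut {X Y : Type*} [Fintype X] [Fintype Y]
    (Q : X → Y → Y → ℝ) (P : X → Y → ℝ) (y' y : Y) : ℝ :=
  (∑ x : X, P x y' * Q x y' y) / (∑ x : X, P x y')


section PostHelpers

variable {α : Type*} [Fintype α]

lemma prevState_cons_zero (n : ℕ) (y0 y1 : α) (ys : Fin n → α) :
    prevState (n + 1) y0 (Fin.cons y1 ys : Fin (n + 1) → α) 0 = y0 := by
  simp [prevState]

lemma prevState_cons_succ (n : ℕ) (y0 y1 : α) (ys : Fin n → α) (t : Fin n) :
    prevState (n + 1) y0 (Fin.cons y1 ys : Fin (n + 1) → α) t.succ = prevState n y1 ys t := by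
  rcases t with ⟨t, ht⟩
  cases t with
  | zero => simp [prevState]
  | succ t =>
    simp only [prevState, Fin.succ_mk]
    rw [if_neg (by simp), if_neg (by simp)]
    exact Fin.cons_succ (α := fun _ => α) y1 ys (⟨t, by omega⟩ : Fin n)

/-- Path weight under time-dependent kernels. -/
def pathW (n : ℕ) (K : Fin n → α → α → ℝ) (y0 : α) (ys : Fin n → α) : ℝ :=
  ∏ s : Fin n, K s (prevState n y0 ys s) (ys s)

lemma pathW_cons (n : ℕ) (K : Fin (n + 1) → α → α → ℝ) (y0 y1 : α) (ys : Fin n → α) :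
    pathW (n + 1) K y0 (Fin.cons y1 ys : Fin (n + 1) → α) =
      K 0 y0 y1 * pathW n (fun s => K s.succ) y1 ys := by
  unfold pathW
  rw [Fin.prod_univ_succ]
  simp only [prevState_cons_zero, prevState_cons_succ, Fin.cons_zero, Fin.cons_succ]

lemma sum_path_succ (n : ℕ) (F : (Fin (n + 1) → α) → ℝ) :
    ∑ ys : Fin (n + 1) → α, F ys =
      ∑ y1 : α, ∑ ys : Fin n → α, F (Fin.cons y1 ys : Fin (n + 1) → α) := by
  rw [← Fintype.sum_prod_type']
  exact (Equiv.sum_comp (Fin.consEquiv (fun _ : Fin (n + 1) => α)) F).symm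

lemma path_mass (S : α → Prop) (n : ℕ) : ∀ (K : Fin n → α → α → ℝ)
    (_ : ∀ s y y1, S y → K s y y1 ≠ 0 → S y1)
    (_ : ∀ s y, S y → ∑ y1, K s y y1 = 1) (y0 : α) (_ : S y0),
    ∑ ys : Fin n → α, pathW n K y0 ys = 1 := by
  induction n with
  | zero => intro K _ _ y0 _; simp [pathW]
  | succ n ih =>
    intro K h1 h2 y0 h0
    rw [sum_path_succ]
    simp only [pathW_cons, ← Finset.mul_sum]
    rw [← h2 0 y0 h0]
    refine Finset.sum_congr rfl fun y1 _ => ?_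
    by_cases hK : K 0 y0 y1 = 0
    · simp [hK]
    · rw [ih _ (fun s => h1 s.succ) (fun s => h2 s.succ) y1 (h1 0 y0 y1 h0 hK), mul_one]

lemma path_step (n : ℕ) : ∀ (K : Fin n → α → α → ℝ)
    (_ : ∀ s y, ∑ y1, K s y y1 = 1) (f : α → α → ℝ) (t : Fin n) (y0 : α),
    ∑ ys : Fin n → α, pathW n K y0 ys * f (prevState n y0 ys t) (ys t) =
    ∑ ys : Fin n → α, pathW n K y0 ys *
      ∑ y, K t (prevState n y0 ys t) y * f (prevState n y0 ys t) y := by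
  induction n with
  | zero => intro K _ f t; exact t.elim0
  | succ n ih =>
    intro K h2 f t y0
    have hm : ∀ y1, ∑ ys : Fin n → α, pathW n (fun s => K s.succ) y1 ys = 1 := fun y1 =>
      path_mass (fun _ => True) n _ (fun _ _ _ _ _ => trivial) (fun s y _ => h2 _ y) y1 trivial
    rw [sum_path_succ, sum_path_succ]
    refine Fin.cases ?_ (fun t => ?_) t
    · simp only [pathW_cons, prevState_cons_zero, Fin.cons_zero, ← Finset.sum_mul,
        ← Finset.mul_sum, hm, mul_one, h2, one_mul]
    · simp only [pathW_cons, prevState_cons_succ, Fin.cons_succ, mul_assoc, ← Finset.mul_sum]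
      refine Finset.sum_congr rfl fun y1 _ => ?_
      rw [ih (fun s => K s.succ) (fun s => h2 s.succ) f t y1]

lemma path_stat (π : α → ℝ) (R : α → α → ℝ)
    (hcl : ∀ y y1, π y ≠ 0 → R y y1 ≠ 0 → π y1 ≠ 0)
    (hrow : ∀ y, π y ≠ 0 → ∑ y1, R y y1 = 1)
    (hst : ∀ y1, ∑ y, π y * R y y1 = π y1) (f : α → α → ℝ) (n : ℕ) : ∀ t : Fin n,
    ∑ y0, ∑ ys : Fin n → α, π y0 * pathW n (fun _ => R) y0 ys * f (prevState n y0 ys t) (ys t) =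
    ∑ y', ∑ y, π y' * R y' y * f y' y := by
  induction n with
  | zero => intro t; exact t.elim0
  | succ n ih =>
    intro t
    simp only [sum_path_succ]
    refine Fin.cases ?_ (fun t => ?_) t
    · simp only [pathW_cons, prevState_cons_zero, Fin.cons_zero, ← Finset.sum_mul,
        ← Finset.mul_sum]
      refine Finset.sum_congr rfl fun y0 _ => Finset.sum_congr rfl fun y1 _ => ?_
      by_cases h0 : π y0 = 0
      · simp [h0]
      by_cases hR : R y0 y1 = 0
      · simp [hR]
      rw [path_mass (fun y => π y ≠ 0) n _ (fun _ => hcl) (fun _ => hrow) y1 (hcl _ _ h0 hR),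
        mul_one]
    · simp only [pathW_cons, prevState_cons_succ, Fin.cons_succ]
      rw [← ih t, Finset.sum_comm]
      refine Finset.sum_congr rfl fun y1 _ => ?_
      rw [Finset.sum_comm]
      refine Finset.sum_congr rfl fun ys _ => ?_
      rw [← hst y1, Finset.sum_mul, Finset.sum_mul]
      refine Finset.sum_congr rfl fun y0 _ => ?_
      ring

end PostHelpers

lemma condMI_le {A B C : Type*} [Fintype A] [Fintype B] [Fintype C]
    (J : A → B → C → ℝ) (h0 : ∀ a b c, 0 ≤ J a b c)
    (h1 : ∀ c, ∑ a, ∑ b, J a b c ≤ 1) :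
    condMI J ≤ ∑ _a : A, ∑ _b : B, ∑ _c : C, (1 : ℝ) := by
  unfold condMI
  refine Finset.sum_le_sum fun a _ => Finset.sum_le_sum fun b _ => Finset.sum_le_sum fun c _ => ?_
  rcases (h0 a b c).eq_or_lt with h | h
  · simp [← h]
  have ha : J a b c ≤ ∑ b', J a b' c :=
    Finset.single_le_sum (f := fun b' => J a b' c) (fun i _ => h0 a i c) (Finset.mem_univ b)
  have hb : J a b c ≤ ∑ a', J a' b c :=
    Finset.single_le_sum (f := fun a' => J a' b c) (fun i _ => h0 i b c) (Finset.mem_univ a)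
  have hc0 : 0 ≤ ∑ a, ∑ b, J a b c :=
    Finset.sum_nonneg fun a _ => Finset.sum_nonneg fun b _ => h0 a b c
  have hc := h1 c
  set p := J a b c
  set u := ∑ b', J a b' c
  set v := ∑ a', J a' b c
  set w := ∑ a, ∑ b, J a b c
  have hu : 0 < u := h.trans_le ha
  have hv : 0 < v := h.trans_le hb
  have hr : 0 ≤ p * w / (u * v) := by positivity
  calc p * Real.log (p * w / (u * v)) ≤ p * (p * w / (u * v)) :=
        mul_le_mul_of_nonneg_left (Real.log_le_self hr) h.le
    _ = (p * p * w) / (u * v) := by ring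
    _ ≤ 1 := by
      rw [div_le_one (by positivity)]
      calc p * p * w ≤ p * p * 1 := by gcongr
        _ ≤ u * v := by rw [mul_one]; gcongr

section PostMain

variable {α : Type*} [Fintype α]

lemma nLaw_eq (Q : α → α → α → ℝ) (n : ℕ) (P : (Fin n → α) → α → ℝ) (xs ys : Fin n → α) (y0 : α) :
    nLaw Q n P xs ys y0 = P xs y0 * pathW n (fun s => Q (xs s)) y0 ys := rfl

lemma nLaw_sum_ys (Q : α → α → α → ℝ) (hQ : IsPOST Q) (n : ℕ) (P : (Fin n → α) → α → ℝ)
    (xs : Fin n → α) (y0 : α) :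
    ∑ ys, nLaw Q n P xs ys y0 = P xs y0 := by
  simp only [nLaw_eq, ← Finset.mul_sum]
  rw [path_mass (fun _ => True) n _ (fun _ _ _ _ _ => trivial)
    (fun s y _ => hQ.2 _ y) y0 trivial, mul_one]

lemma nLaw_nonneg (Q : α → α → α → ℝ) (hQ : IsPOST Q) (n : ℕ) (P : (Fin n → α) → α → ℝ)
    (hP : IsJointPmfN n P) (xs ys : Fin n → α) (y0 : α) : 0 ≤ nLaw Q n P xs ys y0 :=
  mul_nonneg (hP.1 _ _) (Finset.prod_nonneg fun _ _ => hQ.1 _ _ _)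

lemma bddAbove_Cn (Q : α → α → α → ℝ) (hQ : IsPOST Q) (n : ℕ) :
    BddAbove {r : ℝ | ∃ P : (Fin n → α) → α → ℝ, IsJointPmfN n P ∧
      r = (1 / (n : ℝ)) * condMI (nLaw Q n P)} := by
  refine ⟨(1 / (n : ℝ)) *
    ∑ _a : Fin n → α, ∑ _b : Fin n → α, ∑ _c : α, (1 : ℝ), ?_⟩
  rintro r ⟨P, hP, rfl⟩
  refine mul_le_mul_of_nonneg_left (condMI_le _ (nLaw_nonneg Q hQ n P hP) fun c => ?_)
    (by positivity)
  simp only [nLaw_sum_ys Q hQ]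
  rw [← hP.2]
  refine Finset.sum_le_sum fun xs _ => ?_
  exact Finset.single_le_sum (f := fun y => P xs y) (fun i _ => hP.1 xs i) (Finset.mem_univ c)

variable [DecidableEq α]

lemma key_expect (Q : α → α → α → ℝ) (hQ : IsPOST Q)
    (hinv : ∀ y' : α, IsUnit ((Matrix.of fun y x => Q x y' y) : Matrix α α ℝ))
    (Ps : α → α → ℝ) (hPs : IsJointPmf Ps) (hst : StationaryFor Q Ps)
    (n : ℕ) (P : (Fin n → α) → α → ℝ)
    (hout : ∀ (ys : Fin n → α) (y0 : α),
      (∑ xs : Fin n → α, nLaw Q n P xs ys y0) =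
        (∑ x : α, Ps x y0) *
          ∏ t : Fin n, condOut Q Ps (prevState n y0 ys t) (ys t))
    (t : Fin n) (g : α → α → α → ℝ) :
    ∑ xs, ∑ ys, ∑ y0, nLaw Q n P xs ys y0 * g (xs t) (prevState n y0 ys t) (ys t) =
      ∑ x, ∑ y, ∑ y', Ps x y' * Q x y' y * g x y' y := by
  set π : α → ℝ := fun y => ∑ x, Ps x y with hπ
  have hπ0 : ∀ y x, π y = 0 → Ps x y = 0 := fun y x h =>
    (Finset.sum_eq_zero_iff_of_nonneg (fun i _ => hPs.1 i y)).1 h x (Finset.mem_univ x)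
  have hπR : ∀ y' y, π y' * condOut Q Ps y' y = ∑ x, Ps x y' * Q x y' y := by
    intro y' y
    by_cases h : π y' = 0
    · rw [h, zero_mul]
      symm
      exact Finset.sum_eq_zero fun x _ => by rw [hπ0 y' x h, zero_mul]
    · exact mul_div_cancel₀ _ h
  have hstat : ∀ y, ∑ y', π y' * condOut Q Ps y' y = π y := by
    intro y
    simp only [hπR]
    rw [Finset.sum_comm]
    exact hst y
  have hπnn : ∀ y, 0 ≤ π y := fun y => Finset.sum_nonneg fun x _ => hPs.1 x y
  have hnn : ∀ y' y, 0 ≤ π y' * condOut Q Ps y' y := by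
    intro y' y
    rw [hπR]
    exact Finset.sum_nonneg fun x _ => mul_nonneg (hPs.1 _ _) (hQ.1 _ _ _)
  have hcl : ∀ y y1, π y ≠ 0 → condOut Q Ps y y1 ≠ 0 → π y1 ≠ 0 := by
    intro y y1 h1 h2 h3
    have := (Finset.sum_eq_zero_iff_of_nonneg (fun i _ => hnn i y1)).1
      ((hstat y1).trans h3) y (Finset.mem_univ y)
    exact (mul_ne_zero h1 h2) this
  have hrow : ∀ y, π y ≠ 0 → ∑ y1, condOut Q Ps y y1 = 1 := by
    intro y h
    apply mul_left_cancel₀ h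
    rw [Finset.mul_sum, mul_one]
    simp only [hπR]
    rw [Finset.sum_comm]
    simp only [← Finset.mul_sum, hQ.2, mul_one, hπ]
  -- one-step conditional expectation
  have hstep : ∀ g : α → α → α → ℝ,
      ∑ xs, ∑ ys, ∑ y0, nLaw Q n P xs ys y0 * g (xs t) (prevState n y0 ys t) (ys t) =
      ∑ xs, ∑ ys, ∑ y0, nLaw Q n P xs ys y0 *
        ∑ y, Q (xs t) (prevState n y0 ys t) y * g (xs t) (prevState n y0 ys t) y := by
    intro g
    refine Finset.sum_congr rfl fun xs _ => ?_
    rw [Finset.sum_comm, Finset.sum_comm (s := Finset.univ (α := Fin n → α))]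
    refine Finset.sum_congr rfl fun y0 _ => ?_
    simp only [nLaw_eq, mul_assoc, ← Finset.mul_sum]
    rw [path_step n (fun s => Q (xs s)) (fun s y => hQ.2 _ y) (g (xs t)) t y0]
  -- marginal law of input and previous state
  set L : α → α → ℝ := fun x y' => ∑ xs, ∑ ys, ∑ y0, nLaw Q n P xs ys y0 *
    (if xs t = x ∧ prevState n y0 ys t = y' then 1 else 0) with hL
  have hLsum : ∀ h : α → α → ℝ,
      ∑ xs, ∑ ys, ∑ y0, nLaw Q n P xs ys y0 * h (xs t) (prevState n y0 ys t) =
      ∑ x, ∑ y', L x y' * h x y' := by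
    intro h
    have e : ∀ a b, h a b = ∑ x, ∑ y', (if a = x ∧ b = y' then (1 : ℝ) else 0) * h x y' := by
      intro a b
      simp [ite_and]
    simp only [hL, Finset.sum_mul]
    rw [← Fintype.sum_prod_type' (f := fun x y' => ∑ xs, ∑ ys, ∑ y0, nLaw Q n P xs ys y0 *
      (if xs t = x ∧ prevState n y0 ys t = y' then 1 else 0) * h x y')]
    rw [Finset.sum_comm (s := Finset.univ (α := α × α))]
    refine Finset.sum_congr rfl fun xs _ => ?_
    rw [Finset.sum_comm (s := Finset.univ (α := α × α))]
    refine Finset.sum_congr rfl fun ys _ => ?_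
    rw [Finset.sum_comm (s := Finset.univ (α := α × α))]
    refine Finset.sum_congr rfl fun y0 _ => ?_
    rw [Fintype.sum_prod_type, e (xs t), Finset.mul_sum]
    refine Finset.sum_congr rfl fun x _ => ?_
    rw [Finset.mul_sum]
    refine Finset.sum_congr rfl fun y' _ => ?_
    ring
  have hLQ : ∀ y' y, ∑ x, Q x y' y * L x y' = ∑ x, Q x y' y * Ps x y' := by
    intro y' y
    have h1 := hstep (fun _ b c => if b = y' ∧ c = y then 1 else 0)
    have h2 := hLsum (fun a b => ∑ c, Q a b c * if b = y' ∧ c = y then 1 else 0)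
    have h3 : ∑ xs, ∑ ys, ∑ y0, nLaw Q n P xs ys y0 *
        (if prevState n y0 ys t = y' ∧ ys t = y then 1 else 0) =
        ∑ x, Ps x y' * Q x y' y := by
      rw [← hπR]
      have h4 := path_stat π (condOut Q Ps) hcl hrow hstat
        (fun b c => if b = y' ∧ c = y then 1 else 0) n t
      have h5 : ∑ b, ∑ c, π b * condOut Q Ps b c * (if b = y' ∧ c = y then (1 : ℝ) else 0) =
          π y' * condOut Q Ps y' y := by
        simp [ite_and]
      rw [← h5, ← h4, Finset.sum_comm, Finset.sum_comm (s := Finset.univ (α := α))]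
      refine Finset.sum_congr rfl fun ys _ => ?_
      rw [Finset.sum_comm]
      refine Finset.sum_congr rfl fun y0 _ => ?_
      rw [← Finset.sum_mul, hout]
      rfl
    have h6 : ∑ x, ∑ b, L x b * (∑ c, Q x b c * if b = y' ∧ c = y then 1 else 0) =
        ∑ x, Q x y' y * L x y' := by
      refine Finset.sum_congr rfl fun x _ => ?_
      simp [ite_and, mul_comm]
    rw [← h6, ← h2, ← h1, h3]
    exact Finset.sum_congr rfl fun x _ => mul_comm _ _
  have hLP : ∀ x y', L x y' = Ps x y' := by
    intro x y'
    have hinj := Matrix.mulVec_injective_of_isUnit (hinv y')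
    have : (fun x => L x y') = fun x => Ps x y' := by
      apply hinj
      funext y
      exact hLQ y' y
    exact congrFun this x
  rw [hstep, hLsum (fun a b => ∑ y, Q a b y * g a b y)]
  refine Finset.sum_congr rfl fun x _ => ?_
  rw [Finset.sum_comm]
  refine Finset.sum_congr rfl fun y' _ => ?_
  rw [hLP, Finset.mul_sum]
  exact Finset.sum_congr rfl fun y _ => by ring

end PostMain

/-- For a POST channel with `|𝒳| = |𝒴|` and invertible channel
transition matrices: if a non-feedback input distribution whose initial-state marginal
is `P*_{Y'}` simulates the Markov output law generated by a maximizer `P*` of the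
feedback problem, then `I(X^n;Y^n|Y_0) = n · C*_f(Q)` and hence `C_n(Q) ≥ C*_f(Q)`. -/
theorem simulation_gives_Cn_ge_Cfstar
    {α : Type*} [Fintype α] [DecidableEq α] (hα : 2 ≤ Fintype.card α)
    (Q : α → α → α → ℝ) (hQ : IsPOST Q)
    (hinv : ∀ y' : α, IsUnit ((Matrix.of fun y x => Q x y' y) : Matrix α α ℝ))
    (Pstar : α → α → ℝ) (hPstar : IsFbMaximizer Q Pstar)
    (n : ℕ) (hn : 0 < n)
    (P : (Fin n → α) → α → ℝ) (hP : IsJointPmfN n P)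
    (hmarg0 : ∀ y0 : α, ∑ xs : Fin n → α, P xs y0 = ∑ x : α, Pstar x y0)
    (hout : ∀ (ys : Fin n → α) (y0 : α),
      (∑ xs : Fin n → α, nLaw Q n P xs ys y0) =
        (∑ x : α, Pstar x y0) *
          ∏ t : Fin n, condOut Q Pstar (prevState n y0 ys t) (ys t)) :
    condMI (nLaw Q n P) = (n : ℝ) * Cfstar Q ∧ Cfstar Q ≤ Cn Q n := by
  obtain ⟨hPs, hst, hmax⟩ := hPstar
  have hCf : Cfstar Q = fbMI Q Pstar := by
    apply IsGreatest.csSup_eq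
    refine ⟨⟨Pstar, hPs, hst, rfl⟩, ?_⟩
    rintro r ⟨P', h1, h2, rfl⟩
    exact hmax P' h1 h2
  have hπ0 : ∀ y x, ∑ x, Pstar x y = 0 → Pstar x y = 0 := fun y x h =>
    (Finset.sum_eq_zero_iff_of_nonneg (fun i _ => hPs.1 i y)).1 h x (Finset.mem_univ x)
  have hfb : fbMI Q Pstar = ∑ x, ∑ y, ∑ y', Pstar x y' * Q x y' y *
      Real.log (Q x y' y / condOut Q Pstar y' y) := by
    unfold fbMI condMI
    refine Finset.sum_congr rfl fun x _ => Finset.sum_congr rfl fun y _ =>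
      Finset.sum_congr rfl fun y' _ => ?_
    simp only [← Finset.mul_sum, hQ.2, mul_one]
    by_cases hp : Pstar x y' = 0
    · simp [hp]
    have hπ : ∑ x, Pstar x y' ≠ 0 := fun h => hp (hπ0 y' x h)
    congr 2
    unfold condOut
    rw [mul_assoc, mul_div_mul_left _ _ hp, div_div_eq_mul_div]
  have hmain : condMI (nLaw Q n P) = (n : ℝ) * Cfstar Q := by
    have hterm : ∀ xs ys y0, nLaw Q n P xs ys y0 *
        Real.log ((nLaw Q n P xs ys y0 * ∑ a', ∑ b', nLaw Q n P a' b' y0) /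
        ((∑ b', nLaw Q n P xs b' y0) * (∑ a', nLaw Q n P a' ys y0))) =
        ∑ t, nLaw Q n P xs ys y0 * Real.log (Q (xs t) (prevState n y0 ys t) (ys t) /
          condOut Q Pstar (prevState n y0 ys t) (ys t)) := by
      intro xs ys y0
      by_cases hJ : nLaw Q n P xs ys y0 = 0
      · simp [hJ]
      have hsum : ∑ a', nLaw Q n P a' ys y0 ≠ 0 := fun h =>
        hJ ((Finset.sum_eq_zero_iff_of_nonneg
          (fun i _ => nLaw_nonneg Q hQ n P hP i ys y0)).1 h xs (Finset.mem_univ xs))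
      simp only [nLaw_sum_ys Q hQ]
      rw [hout] at hsum ⊢
      rw [hmarg0, ← Finset.mul_sum]
      congr 1
      have hp : P xs y0 ≠ 0 := left_ne_zero_of_mul hJ
      have hq : ∏ t : Fin n, Q (xs t) (prevState n y0 ys t) (ys t) ≠ 0 :=
        right_ne_zero_of_mul hJ
      have hπ := left_ne_zero_of_mul hsum
      have hr := right_ne_zero_of_mul hsum
      rw [← Real.log_prod (fun t _ => div_ne_zero (Finset.prod_ne_zero_iff.1 hq t (Finset.mem_univ t))
        (Finset.prod_ne_zero_iff.1 hr t (Finset.mem_univ t))), Finset.prod_div_distrib]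
      congr 1
      unfold nLaw
      field_simp
    unfold condMI
    simp only [hterm]
    have hsw : ∑ xs, ∑ ys, ∑ y0, ∑ t, nLaw Q n P xs ys y0 *
          Real.log (Q (xs t) (prevState n y0 ys t) (ys t) /
          condOut Q Pstar (prevState n y0 ys t) (ys t)) =
        ∑ t, ∑ xs, ∑ ys, ∑ y0, nLaw Q n P xs ys y0 *
          Real.log (Q (xs t) (prevState n y0 ys t) (ys t) /
          condOut Q Pstar (prevState n y0 ys t) (ys t)) := by
      rw [Finset.sum_comm (s := Finset.univ (α := Fin n))]
      refine Finset.sum_congr rfl fun xs _ => ?_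
      rw [Finset.sum_comm (s := Finset.univ (α := Fin n))]
      refine Finset.sum_congr rfl fun ys _ => ?_
      rw [Finset.sum_comm]
    rw [hsw, hCf, hfb]
    rw [Finset.sum_congr rfl fun t _ => key_expect Q hQ hinv Pstar hPs hst n P hout t
      (fun x y' y => Real.log (Q x y' y / condOut Q Pstar y' y))]
    rw [Finset.sum_const, Finset.card_univ, Fintype.card_fin, nsmul_eq_mul]
  refine ⟨hmain, ?_⟩
  refine le_csSup (bddAbove_Cn Q hQ n) ⟨P, hP, ?_⟩
  rw [hmain]
  have : (n : ℝ) ≠ 0 := by positivity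
  field_simp
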